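/- Concentration of the empirical conditional means (Lemma 2, part 3): Let ε = sqrt((2/(p·B))·ln(16·p·M·B)) and assume ε ≤ sqrt(p/2). Then for any fixed i ∈ {1,…,M} and x ∈ {0,1}, after B i.i.d. samples from ν, P( |μ̂_{i,x} − μ_{i,x}| ≥ ε ) ≤ 4·e^{−ε²·p·B}. -/

import Mathlib

open MeasureTheory Real

/-- A joint observation `(X_1,…,X_M, Y)` with all coordinates in `{0,1}`. -/
abbrev ObsVec (M : ℕ) := (Fin M → Bool) × Bool

/-- `p_{i,x} = P(X_i = x)` under `ν`. -/
noncomputable def pix {M : ℕ} (ν : Measure (ObsVec M)) (i : Fin M) (x : Bool) : ℝ :=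
  (ν {v | v.1 i = x}).toReal

/-- `p = min_{i,x} p_{i,x}`. -/
noncomputable def pmin {M : ℕ} (ν : Measure (ObsVec M)) : ℝ :=
  sInf (Set.range fun q : Fin M × Bool => pix ν q.1 q.2)

/-- `μ_{i,x} = E[Y | X_i = x]` (for `{0,1}`-valued `Y`). -/
noncomputable def muix {M : ℕ} (ν : Measure (ObsVec M)) (i : Fin M) (x : Bool) : ℝ :=
  (ν {v | v.1 i = x ∧ v.2 = true}).toReal / pix ν i x

/-- number of samples `t ≤ B` with `X_i^t = x`. -/
def cnt {M B : ℕ} (ω : Fin B → ObsVec M) (i : Fin M) (x : Bool) : ℕ :=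
  (Finset.univ.filter fun t : Fin B => (ω t).1 i = x).card

/-- empirical estimate `μ̂_{i,x} = (∑_t Y^t·1{X_i^t = x})/(∑_t 1{X_i^t = x})`,
`0` when the denominator is `0`. -/
noncomputable def muhatix {M B : ℕ} (ω : Fin B → ObsVec M) (i : Fin M) (x : Bool) : ℝ :=
  if cnt ω i x = 0 then 0
  else (∑ t : Fin B, if (ω t).1 i = x ∧ (ω t).2 = true then (1 : ℝ) else 0) / (cnt ω i x : ℝ)

/-- **Hoeffding's lemma** on an event `A`: the exponential moment, restricted to `A`, of a
`[0,1]`-valued variable centred at its conditional mean given `A`. -/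
theorem setIntegral_exp_centered_le {Ω : Type*} [MeasurableSpace Ω] (P : Measure Ω)
    [IsProbabilityMeasure P] {A : Set Ω} (hA : P A ≠ 0) {Y : Ω → ℝ}
    (hY : Measurable Y) (hY01 : ∀ v, Y v ∈ Set.Icc (0 : ℝ) 1) (s : ℝ) :
    ∫ v in A, exp (s * (Y v - (∫ u in A, Y u ∂P) / P.real A)) ∂P
      ≤ P.real A * exp (s ^ 2 / 8) := by
  have hq : 0 < P.real A := ENNReal.toReal_pos hA (measure_ne_top _ _)
  have : IsProbabilityMeasure (ProbabilityTheory.cond P A) :=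
    ProbabilityTheory.cond_isProbabilityMeasure hA
  have hcond (f : Ω → ℝ) :
      ∫ v, f v ∂(ProbabilityTheory.cond P A) = (∫ v in A, f v ∂P) / P.real A := by
    rw [ProbabilityTheory.cond, integral_smul_measure, ENNReal.toReal_inv, smul_eq_mul,
      div_eq_inv_mul, Measure.real]
  have h := (ProbabilityTheory.hasSubgaussianMGF_of_mem_Icc
    (μ := ProbabilityTheory.cond P A) hY.aemeasurable (ae_of_all _ hY01)).mgf_le s
  simp only [ProbabilityTheory.mgf, hcond] at h
  rw [div_le_iff₀ hq] at h
  refine h.trans_eq ?_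
  rw [mul_comm]
  congr 2
  norm_num
  ring

/-- **Chernoff bound** for a sum of i.i.d. copies of a function on a finite space. -/
theorem measureReal_pi_nonneg_sum_le {Ω : Type*} [MeasurableSpace Ω] [Finite Ω]
    [MeasurableSingletonClass Ω] (P : Measure Ω) [IsProbabilityMeasure P] (B : ℕ) (W : Ω → ℝ) :
    (Measure.pi fun _ : Fin B => P).real {ω | 0 ≤ ∑ t, W (ω t)} ≤ (∫ v, exp (W v) ∂P) ^ B := by
  have h := ProbabilityTheory.measure_ge_le_exp_mul_mgf
    (μ := Measure.pi fun _ : Fin B => P) (X := fun ω => ∑ t, W (ω t)) 0 zero_le_one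
    Integrable.of_finite
  refine h.trans_eq ?_
  simp only [ProbabilityTheory.mgf, mul_zero, exp_zero, one_mul, exp_sum]
  rw [integral_fintype_prod_eq_pow (fun v => exp (W v)), Fintype.card_fin]

theorem exp_neg_le_one_sub_half {u : ℝ} (h0 : 0 ≤ u) (h1 : u ≤ 1) : exp (-u) ≤ 1 - u / 2 := by
  have h2 : (1 + u) * exp (-u) ≤ 1 := by
    calc (1 + u) * exp (-u) ≤ exp u * exp (-u) := by
          gcongr
          linarith [add_one_le_exp u]
      _ = 1 := by rw [← exp_add, add_neg_cancel, exp_zero]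
  nlinarith [mul_nonneg h0 (sub_nonneg.2 h1)]

/-- One-sided tail bound for an empirical conditional mean, without conditioning on the number of
samples falling in `A`. -/
theorem measureReal_pi_conditional_tail_le {Ω : Type*} [MeasurableSpace Ω] [Finite Ω]
    [MeasurableSingletonClass Ω] (P : Measure Ω) [IsProbabilityMeasure P] (B : ℕ)
    {A : Set Ω} (hA : P A ≠ 0) {Y : Ω → ℝ} (hY01 : ∀ v, Y v ∈ Set.Icc (0 : ℝ) 1)
    {ε σ : ℝ} (hσ : σ ^ 2 = 1) (hε : 2 * ε ^ 2 ≤ 1) :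
    (Measure.pi fun _ : Fin B => P).real {ω | 0 ≤ ∑ t, A.indicator
        (fun v => 4 * ε * (σ * (Y v - (∫ u in A, Y u ∂P) / P.real A) - ε)) (ω t)}
      ≤ exp (-(ε ^ 2) * P.real A * B) := by
  refine (measureReal_pi_nonneg_sum_le P B _).trans ?_
  set m := (∫ u in A, Y u ∂P) / P.real A with hm
  have hAm : MeasurableSet A := A.toFinite.measurableSet
  have hsplit : ∫ v, exp (A.indicator (fun v => 4 * ε * (σ * (Y v - m) - ε)) v) ∂P
      = exp (-(4 * ε ^ 2)) * ∫ v in A, exp (4 * ε * σ * (Y v - m)) ∂P + (1 - P.real A) := by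
    rw [← integral_add_compl hAm Integrable.of_finite, ← integral_const_mul]
    congr 1
    · refine setIntegral_congr_fun hAm fun v hv => ?_
      simp only [Set.indicator_of_mem hv, ← exp_add]
      congr 1
      ring
    · rw [← probReal_compl_eq_one_sub hAm,
        setIntegral_congr_fun (g := fun _ => (1 : ℝ)) hAm.compl fun v hv => by
          simp only [Set.indicator_of_notMem hv, exp_zero]]
      simp
  have hH := setIntegral_exp_centered_le P hA (measurable_of_finite Y) hY01 (4 * ε * σ)
  rw [← hm] at hH
  have hbase : ∫ v, exp (A.indicator (fun v => 4 * ε * (σ * (Y v - m) - ε)) v) ∂P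
      ≤ exp (-(ε ^ 2) * P.real A) := by
    rw [hsplit]
    calc _ ≤ exp (-(4 * ε ^ 2)) * (P.real A * exp ((4 * ε * σ) ^ 2 / 8)) + (1 - P.real A) := by
          gcongr
      _ = P.real A * exp (-(2 * ε ^ 2)) + (1 - P.real A) := by
          rw [mul_left_comm, ← exp_add]
          congr 3
          rw [mul_pow, hσ]
          ring
      _ ≤ P.real A * (1 - 2 * ε ^ 2 / 2) + (1 - P.real A) := by
          gcongr
          exact exp_neg_le_one_sub_half (by positivity) hε
      _ = -(ε ^ 2) * P.real A + 1 := by ring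
      _ ≤ _ := add_one_le_exp _
  calc _ ≤ exp (-(ε ^ 2) * P.real A) ^ B :=
        pow_le_pow_left₀ (integral_nonneg fun _ => (exp_pos _).le) hbase B
    _ = _ := by rw [← exp_nat_mul, mul_comm]

theorem pmin_le_pix {M : ℕ} (ν : Measure (ObsVec M)) (i : Fin M) (x : Bool) :
    pmin ν ≤ pix ν i x :=
  csInf_le (Set.finite_range _).bddBelow ⟨(i, x), rfl⟩

theorem setIntegral_label {M : ℕ} (ν : Measure (ObsVec M)) [IsProbabilityMeasure ν]
    (i : Fin M) (x : Bool) :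
    ∫ v in {v : ObsVec M | v.1 i = x}, (if v.2 = true then (1 : ℝ) else 0) ∂ν
      = ν.real {v | v.1 i = x ∧ v.2 = true} := by
  have h : (fun v : ObsVec M => if v.2 = true then (1 : ℝ) else 0)
      = {v : ObsVec M | v.2 = true}.indicator 1 := by
    ext v
    simp [Set.indicator_apply]
  rw [h, integral_indicator_one (Set.toFinite _).measurableSet,
    measureReal_restrict_apply (Set.toFinite _).measurableSet, Set.inter_comm]
  rfl

/-- When the empirical conditional mean deviates by `ε` in direction `σ`, the associated sum of
indicator terms is nonnegative. -/
theorem nonneg_sum_indicator_of_deviation {M B : ℕ} (ω : Fin B → ObsVec M) (i : Fin M) (x : Bool)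
    {ε σ m : ℝ} (hε : 0 ≤ ε) (h : ε ≤ σ * (muhatix ω i x - m)) :
    0 ≤ ∑ t, {v : ObsVec M | v.1 i = x}.indicator
      (fun v => 4 * ε * (σ * ((if v.2 = true then (1 : ℝ) else 0) - m) - ε)) (ω t) := by
  have hterm (t : Fin B) : {v : ObsVec M | v.1 i = x}.indicator
      (fun v => 4 * ε * (σ * ((if v.2 = true then (1 : ℝ) else 0) - m) - ε)) (ω t)
      = 4 * ε * σ * (if (ω t).1 i = x ∧ (ω t).2 = true then (1 : ℝ) else 0)
        - 4 * ε * (σ * m + ε) * (if (ω t).1 i = x then (1 : ℝ) else 0) := by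
    by_cases h1 : (ω t).1 i = x
    · simp only [Set.indicator_apply, Set.mem_ofPred_eq, h1, if_true, true_and]
      ring
    · simp [h1]
  have hcnt : ∑ t, (if (ω t).1 i = x then (1 : ℝ) else 0) = cnt ω i x := by
    simp [cnt]
  have hsum : ∑ t, (if (ω t).1 i = x ∧ (ω t).2 = true then (1 : ℝ) else 0)
      = muhatix ω i x * cnt ω i x := by
    unfold muhatix
    split_ifs with h0
    · rw [zero_mul]
      refine Finset.sum_eq_zero fun t _ => if_neg fun ht => ?_
      rw [cnt, Finset.card_eq_zero, Finset.filter_eq_empty_iff] at h0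
      exact h0 (Finset.mem_univ t) ht.1
    · rw [div_mul_cancel₀ _ (Nat.cast_ne_zero.2 h0)]
  simp only [hterm]
  rw [Finset.sum_sub_distrib, ← Finset.mul_sum, ← Finset.mul_sum, hcnt, hsum]
  have h' : 0 ≤ 4 * ε * cnt ω i x * (σ * (muhatix ω i x - m) - ε) :=
    mul_nonneg (by positivity) (sub_nonneg.2 h)
  linarith

/-- concentration of the empirical conditional means (Lemma 2, part 3). -/
theorem conditional_means_concentration
    (M B : ℕ) (hM : 2 ≤ M) (hB : 0 < B)
    (ν : Measure (ObsVec M)) [IsProbabilityMeasure ν]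
    (hp : 0 < pmin ν)
    (ε : ℝ)
    (hεdef : ε = Real.sqrt ((2 / (pmin ν * B)) * Real.log (16 * pmin ν * M * B)))
    (hε : ε ≤ Real.sqrt (pmin ν / 2))
    (i : Fin M) (x : Bool) :
    ((Measure.pi fun _ : Fin B => ν)
        {ω : Fin B → ObsVec M | ε ≤ |muhatix ω i x - muix ν i x|}).toReal
      ≤ 4 * Real.exp (-(ε ^ 2) * pmin ν * B) := by
  have hpq := pmin_le_pix ν i x
  have hq : 0 < pix ν i x := hp.trans_le hpq
  have hq1 : pix ν i x ≤ 1 := measureReal_le_one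
  have hε0 : 0 ≤ ε := hεdef ▸ sqrt_nonneg _
  have hε2 : 2 * ε ^ 2 ≤ 1 := by
    have h := pow_le_pow_left₀ hε0 hε 2
    rw [sq_sqrt (by positivity)] at h
    linarith
  have hA : ν {v | v.1 i = x} ≠ 0 := fun h => by simp [pix, h] at hq
  have hm : (∫ v in {v : ObsVec M | v.1 i = x}, (if v.2 = true then (1 : ℝ) else 0) ∂ν)
      / ν.real {v | v.1 i = x} = muix ν i x := by
    rw [setIntegral_label]
    rfl
  have htail {σ : ℝ} (hσ : σ ^ 2 = 1) :
      (Measure.pi fun _ : Fin B => ν).real {ω | ε ≤ σ * (muhatix ω i x - muix ν i x)}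
        ≤ exp (-(ε ^ 2) * pmin ν * B) := by
    have h := measureReal_pi_conditional_tail_le ν B hA
      (Y := fun v => if v.2 = true then (1 : ℝ) else 0)
      (fun v => by split_ifs <;> simp) hσ hε2
    rw [hm] at h
    refine (measureReal_mono fun ω hω =>
      nonneg_sum_indicator_of_deviation ω i x hε0 hω).trans (h.trans ?_)
    have : ε ^ 2 * pmin ν * B ≤ ε ^ 2 * ν.real {v | v.1 i = x} * B := by
      gcongr
      exact hpq
    exact exp_le_exp.2 (by linarith)
  have hsub : {ω : Fin B → ObsVec M | ε ≤ |muhatix ω i x - muix ν i x|}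
      ⊆ {ω | ε ≤ 1 * (muhatix ω i x - muix ν i x)}
        ∪ {ω | ε ≤ -1 * (muhatix ω i x - muix ν i x)} := fun ω hω => by
    simpa only [Set.mem_union, Set.mem_ofPred_eq, one_mul, neg_one_mul] using le_abs.1 hω
  have hunion := (measureReal_mono (μ := Measure.pi fun _ : Fin B => ν) hsub).trans
    (measureReal_union_le _ _)
  have h1 := htail (σ := 1) (by norm_num)
  have h2 := htail (σ := -1) (by norm_num)
  rw [← Measure.real]
  linarith [exp_pos (-(ε ^ 2) * pmin ν * B)]
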